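/- In the doubling procedure applied with parameter δ ∈ (0,1) to a triangle MON (sides OM, ON extended beyond O by factor δ to M', N', D the midpoint of MN), the total area increase satisfies |△MM'D ∪ △NN'D| − |△MON| < 2δ²·|△MON|. -/

import Mathlib

open MeasureTheory

namespace Doubling

abbrev E2 := EuclideanSpace ℝ (Fin 2)

noncomputable def L (u v : E2) : E2 →ₗ[ℝ] E2 :=
  Matrix.toLin (EuclideanSpace.basisFun (Fin 2) ℝ).toBasis (EuclideanSpace.basisFun (Fin 2) ℝ).toBasis
    !![u 0, v 0; u 1, v 1]

lemma L_det (u v : E2) : LinearMap.det (L u v) = u 0 * v 1 - v 0 * u 1 := by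
  rw [L, LinearMap.det_toLin, Matrix.det_fin_two]; simp

lemma L_e0 (u v : E2) : L u v (EuclideanSpace.single 0 1) = u := by
  have h := Matrix.toLin_self (EuclideanSpace.basisFun (Fin 2) ℝ).toBasis
    (EuclideanSpace.basisFun (Fin 2) ℝ).toBasis !![u 0, v 0; u 1, v 1] 0
  simp only [OrthonormalBasis.coe_toBasis, EuclideanSpace.basisFun_apply] at h
  rw [L, h]
  ext i; fin_cases i <;> simp

lemma L_e1 (u v : E2) : L u v (EuclideanSpace.single 1 1) = v := by
  have h := Matrix.toLin_self (EuclideanSpace.basisFun (Fin 2) ℝ).toBasis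
    (EuclideanSpace.basisFun (Fin 2) ℝ).toBasis !![u 0, v 0; u 1, v 1] 1
  simp only [OrthonormalBasis.coe_toBasis, EuclideanSpace.basisFun_apply] at h
  rw [L, h]
  ext i; fin_cases i <;> simp

/-- the triangle with vertex `O` and edge vectors `u`, `v` -/
def tri (O u v : E2) : Set E2 := convexHull ℝ {O + u, O, O + v}

lemma tri_swap (O u v : E2) : tri O u v = tri O v u := by
  unfold tri; congr 1; ext x; simp; tauto

open Pointwise in
lemma vol_tri (O u v : E2) : volume (tri O u v) =
    ENNReal.ofReal |u 0 * v 1 - v 0 * u 1| *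
      volume (tri 0 (EuclideanSpace.single 0 1) (EuclideanSpace.single 1 1)) := by
  rw [← L_det, ← Measure.addHaar_image_linearMap, tri, tri, LinearMap.image_convexHull]
  have : ((fun x => -O + x) ⁻¹' (convexHull ℝ (L u v '' {0 + EuclideanSpace.single 0 1, 0,
      0 + EuclideanSpace.single 1 1}))) = convexHull ℝ {O + u, O, O + v} := by
    rw [Set.image_insert_eq, Set.image_pair]
    simp only [zero_add, L_e0, L_e1, map_zero]
    have h := convexHull_vadd (𝕜 := ℝ) O ({u, 0, v} : Set E2)
    have h2 : O +ᵥ ({u, 0, v} : Set E2) = {O + u, O, O + v} := by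
      ext x; simp [Set.mem_vadd_set, eq_comm]
    rw [h2] at h
    rw [h]
    ext x
    simp [Set.mem_vadd_set_iff_neg_vadd_mem]
  rw [← this, measure_preimage_add]

lemma vol_scale (O u v : E2) (a b : ℝ) :
    (volume (tri O (a • u) (b • v))).toReal = |a * b| * (volume (tri O u v)).toReal := by
  rw [vol_tri, vol_tri O u v, ENNReal.toReal_mul, ENNReal.toReal_mul,
    ENNReal.toReal_ofReal (abs_nonneg _), ENNReal.toReal_ofReal (abs_nonneg _), ← mul_assoc,
    ← abs_mul]
  congr 2; simp; ring

lemma vol_lt_top (O u v : E2) : volume (tri O u v) ≠ ⊤ :=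
  ((Set.toFinite _).isCompact_convexHull (𝕜 := ℝ)).measure_lt_top.ne

lemma mem_tri {O u v x : E2} (s t : ℝ) (hs : 0 ≤ s) (ht : 0 ≤ t) (h : s + t ≤ 1)
    (hx : x = O + s • u + t • v) : x ∈ tri O u v := by
  have hc : Convex ℝ (tri O u v) := convex_convexHull _ _
  have h1 : O + u ∈ tri O u v := subset_convexHull _ _ (by simp)
  have h2 : O ∈ tri O u v := subset_convexHull _ _ (by simp)
  have h3 : O + v ∈ tri O u v := subset_convexHull _ _ (by simp)
  have := hc.sum_mem (t := Finset.univ) (w := ![s, 1 - s - t, t]) (z := ![O + u, O, O + v])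
    (by intro i _; fin_cases i <;> simp <;> linarith)
    (by simp [Fin.sum_univ_three]; ring)
    (by intro i _; fin_cases i <;> simp [h1, h2, h3])
  convert this using 1
  rw [hx]; simp [Fin.sum_univ_three]; module

lemma mem_hull3 {a b c x : E2} (hx : x ∈ convexHull ℝ ({a, b, c} : Set E2)) :
    ∃ α β γ : ℝ, 0 ≤ α ∧ 0 ≤ β ∧ 0 ≤ γ ∧ α + β + γ = 1 ∧ x = α • a + β • b + γ • c := by
  rw [convexHull_insert (by simp), convexHull_pair, mem_convexJoin] at hx
  obtain ⟨p, hp, q, ⟨r, s, hr, hs, hrs, rfl⟩, ⟨t, w, ht, hw, htw, rfl⟩⟩ := hx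
  rw [Set.mem_singleton_iff] at hp
  subst hp
  refine ⟨t, w * r, w * s, ht, by positivity, by positivity, ?_, by module⟩
  linear_combination htw + w * hrs

lemma cover (O u v : E2) (δ : ℝ) (hδ : 0 < δ) :
    convexHull ℝ {O + u, O + (-δ) • u, O + (1 / 2 : ℝ) • (u + v)} ⊆
      tri O u v ∪ tri O ((-δ) • u) ((δ / (1 + 2 * δ)) • v) := by
  intro x hx
  obtain ⟨α, β, γ, ha, hb, hc, hs, rfl⟩ := mem_hull3 hx
  have hO : O = α • O + β • O + γ • O := by rw [← add_smul, ← add_smul, hs, one_smul]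
  have key : α • (O + u) + β • (O + (-δ) • u) + γ • (O + (1 / 2 : ℝ) • (u + v)) =
      O + (α - δ * β + γ / 2) • u + (γ / 2) • v := by
    conv_rhs => rw [hO]
    module
  rw [key]
  have hbd : 0 ≤ δ * β := by positivity
  rcases le_total 0 (α - δ * β + γ / 2) with h | h
  · left
    exact mem_tri _ _ h (by positivity) (by linarith) rfl
  · right
    refine mem_tri (-(α - δ * β + γ / 2) / δ) (γ / 2 * ((1 + 2 * δ) / δ))
      (div_nonneg (by linarith) hδ.le) (by positivity) ?_ ?_
    · rw [← mul_div_assoc, ← add_div, div_le_one hδ]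
      nlinarith
    · rw [smul_smul, smul_smul]
      congr 3 <;> field_simp

lemma vol_pos (M O N : E2) (hnc : ¬ Collinear ℝ ({M, O, N} : Set E2)) :
    0 < volume (convexHull ℝ ({M, O, N} : Set E2)) := by
  have hi := affineIndependent_iff_not_collinear_set.2 hnc
  have ht := (hi.affineSpan_eq_top_iff_card_eq_finrank_add_one).2 (by simp)
  have hr : Set.range ![M, O, N] = {M, O, N} := by
    simp only [Matrix.range_cons, Matrix.range_empty, Set.union_empty]; rfl
  rw [hr] at ht
  have := interior_convexHull_nonempty_iff_affineSpan_eq_top.2 ht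
  exact Measure.measure_pos_of_nonempty_interior _ this

end Doubling

open Doubling in
theorem stmt_15 (M O N : EuclideanSpace ℝ (Fin 2)) (hnc : ¬ Collinear ℝ ({M, O, N} : Set _))
    (δ : ℝ) (hδ0 : 0 < δ) (hδ1 : δ < 1) :
    let M' := O + δ • (O - M)
    let N' := O + δ • (O - N)
    let D := (1 / 2 : ℝ) • (M + N)
    (volume (convexHull ℝ ({M, M', D} : Set _) ∪ convexHull ℝ ({N, N', D} : Set _))).toReal -
        (volume (convexHull ℝ ({M, O, N} : Set _))).toReal <
      2 * δ ^ 2 * (volume (convexHull ℝ ({M, O, N} : Set _))).toReal := by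
  intro M' N' D
  have hpos := vol_pos M O N hnc
  obtain ⟨u, rfl⟩ : ∃ u, M = O + u := ⟨M - O, by abel⟩
  obtain ⟨v, rfl⟩ : ∃ v, N = O + v := ⟨N - O, by abel⟩
  have hM : M' = O + (-δ) • u := by simp only [M']; module
  have hN : N' = O + (-δ) • v := by simp only [N']; module
  have hD : D = O + (1 / 2 : ℝ) • (u + v) := by simp only [D]; module
  have hD2 : D = O + (1 / 2 : ℝ) • (v + u) := by simp only [D]; module
  have c1 := cover O u v δ hδ0
  have c2 := cover O v u δ hδ0
  rw [← hM, ← hD] at c1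
  rw [← hN, ← hD2, tri_swap O v u] at c2
  have hsub := Set.union_subset_union c1 c2
  change 0 < volume (tri O u v) at hpos
  change _ - (volume (tri O u v)).toReal < _ * (volume (tri O u v)).toReal
  set A := tri O u v with hA
  set B := tri O ((-δ) • u) ((δ / (1 + 2 * δ)) • v) with hB
  set C := tri O ((-δ) • v) ((δ / (1 + 2 * δ)) • u) with hC
  have hsub2 : (A ∪ B) ∪ (A ∪ C) = A ∪ B ∪ C := by ext x; simp; tauto
  rw [hsub2] at hsub
  have hle : volume (convexHull ℝ {O + u, M', D} ∪ convexHull ℝ {O + v, N', D}) ≤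
      volume A + volume B + volume C :=
    (measure_mono hsub).trans ((measure_union_le _ _).trans
      (add_le_add_left (measure_union_le _ _) _))
  have fA : volume A ≠ ⊤ := vol_lt_top _ _ _
  have fB : volume B ≠ ⊤ := vol_lt_top _ _ _
  have fC : volume C ≠ ⊤ := vol_lt_top _ _ _
  have hle2 := ENNReal.toReal_mono (by finiteness) hle
  rw [ENNReal.toReal_add (by finiteness) fC, ENNReal.toReal_add fA fB, hB, hC, vol_scale,
    vol_scale, tri_swap O v u, ← hA] at hle2
  have hA0 : 0 < (volume A).toReal := ENNReal.toReal_pos hpos.ne' fA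
  have hlt : |(-δ) * (δ / (1 + 2 * δ))| < δ ^ 2 := by
    rw [neg_mul, abs_neg, abs_of_pos (by positivity), ← mul_div_assoc,
      div_lt_iff₀ (by positivity)]
    nlinarith [pow_pos hδ0 3]
  nlinarith [mul_lt_mul_of_pos_right hlt hA0]
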